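/- (Bernstein Gradient Lower Bound.) Let l < u be real numbers, n ≥ 1 a natural number, δ > 0, and c_0, …, c_n real coefficients satisfying the strict monotonicity condition c_{k+1} − c_k ≥ δ for every k ∈ {0,…,n−1}. Then for every x ∈ [l,u], the derivative of the Bernstein activation satisfies |σ'(x)| ≥ n·δ/(u−l); in fact σ'(x) ≥ n·δ/(u−l) > 0. -/

import Mathlib

/-- The Bernstein basis polynomial of degree `n`, index `k`, on the interval `[l, u]`. -/
noncomputable def bernBasis (l u : ℝ) (n k : ℕ) (x : ℝ) : ℝ :=
  (n.choose k : ℝ) / (u - l) ^ n * (x - l) ^ k * (u - x) ^ (n - k)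

/-- The Bernstein activation with coefficients `c 0, …, c n` on `[l, u]`. -/
noncomputable def bernAct (l u : ℝ) (n : ℕ) (c : ℕ → ℝ) (x : ℝ) : ℝ :=
  ∑ k ∈ Finset.range (n + 1), c k * bernBasis l u n k x

theorem hasDerivAt_bernBasis_zero {l u : ℝ} (h : l < u) (m : ℕ) (x : ℝ) :
    HasDerivAt (bernBasis l u (m + 1) 0)
      ((m + 1) / (u - l) * (0 - bernBasis l u m 0 x)) x := by
  have hne : u - l ≠ 0 := (sub_pos.2 h).ne'
  have hd := ((((hasDerivAt_id x).const_sub u).pow (m + 1)).const_mul (1 / (u - l) ^ (m + 1)))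
  refine (hd.congr_of_eventuallyEq (.of_forall fun y => ?_)).congr_deriv ?_
  · simp [bernBasis]
  · simp only [bernBasis, Nat.choose_zero_right, id, Nat.sub_zero, Nat.add_sub_cancel]
    push_cast
    field_simp
    ring

theorem hasDerivAt_bernBasis_succ {l u : ℝ} (h : l < u) {m k : ℕ} (hk : k ≤ m) (x : ℝ) :
    HasDerivAt (bernBasis l u (m + 1) (k + 1))
      ((m + 1) / (u - l) * (bernBasis l u m k x - bernBasis l u m (k + 1) x)) x := by
  have hne : u - l ≠ 0 := (sub_pos.2 h).ne'
  obtain ⟨j, rfl⟩ := Nat.exists_eq_add_of_le hk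
  have hd := ((((hasDerivAt_id x).sub_const l).pow (k + 1)).const_mul
    (((k + j + 1).choose (k + 1) : ℝ) / (u - l) ^ (k + j + 1))).mul
    (((hasDerivAt_id x).const_sub u).pow j)
  have h₁ : ((k + j : ℕ) + 1 : ℝ) * (k + j).choose k
      = (k + j + 1).choose (k + 1) * (k + 1) := by
    exact_mod_cast Nat.add_one_mul_choose_eq (k + j) k
  have h₂ : ((k + j : ℕ) + 1 : ℝ) * (k + j).choose (k + 1)
      = (k + j + 1).choose (k + 1) * j := by
    have := Nat.choose_mul_succ_eq (k + j) (k + 1)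
    rw [show k + j + 1 - (k + 1) = j by omega] at this
    rw [mul_comm]
    exact_mod_cast this
  refine (hd.congr_of_eventuallyEq (.of_forall fun y => ?_)).congr_deriv ?_
  · simp [bernBasis, show k + j + 1 - (k + 1) = j by omega]
  · simp only [bernBasis, id, Nat.add_sub_cancel, Pi.pow_apply,
      show k + j - k = j by omega, show k + j - (k + 1) = j - 1 by omega]
    rw [Nat.cast_add_one k]
    symm
    trans (((k + j : ℕ) + 1 : ℝ) * (k + j).choose k * (x - l) ^ k * (u - x) ^ j -
      ((k + j : ℕ) + 1 : ℝ) * (k + j).choose (k + 1) * (x - l) ^ (k + 1) * (u - x) ^ (j - 1))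
        / (u - l) ^ (k + j + 1)
    · field_simp
      ring
    · rw [h₁, h₂]
      ring

theorem hasDerivAt_bernAct {l u : ℝ} (h : l < u) (m : ℕ) (c : ℕ → ℝ) (x : ℝ) :
    HasDerivAt (bernAct l u (m + 1) c)
      ((m + 1) / (u - l) *
        ∑ k ∈ Finset.range (m + 1), (c (k + 1) - c k) * bernBasis l u m k x) x := by
  have hd : HasDerivAt
      (fun y => ∑ k ∈ Finset.range (m + 1), c (k + 1) * bernBasis l u (m + 1) (k + 1) y
        + c 0 * bernBasis l u (m + 1) 0 y) _ x :=
    (HasDerivAt.fun_sum fun k hk => (hasDerivAt_bernBasis_succ h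
      (Nat.lt_succ_iff.1 (Finset.mem_range.1 hk)) x).const_mul (c (k + 1))).add
      ((hasDerivAt_bernBasis_zero h m x).const_mul (c 0))
  refine (hd.congr_of_eventuallyEq (.of_forall fun y => ?_)).congr_deriv ?_
  · exact Finset.sum_range_succ' _ _
  · have hz : bernBasis l u m (m + 1) x = 0 := by simp [bernBasis]
    have hs : ∑ k ∈ Finset.range (m + 1), c (k + 1) * bernBasis l u m (k + 1) x
        + c 0 * bernBasis l u m 0 x = ∑ k ∈ Finset.range (m + 1), c k * bernBasis l u m k x := by
      rw [← Finset.sum_range_succ' (fun k => c k * bernBasis l u m k x),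
        Finset.sum_range_succ, hz, mul_zero, add_zero]
    simp only [sub_mul, mul_sub, Finset.sum_sub_distrib, ← hs, mul_left_comm (c _),
      ← Finset.mul_sum]
    ring

theorem sum_bernBasis {l u : ℝ} (h : l < u) (m : ℕ) (x : ℝ) :
    ∑ k ∈ Finset.range (m + 1), bernBasis l u m k x = 1 := by
  have hne : u - l ≠ 0 := (sub_pos.2 h).ne'
  have hb := add_pow (x - l) (u - x) m
  rw [show x - l + (u - x) = u - l by ring] at hb
  rw [← div_self (pow_ne_zero m hne)]
  conv_rhs => rw [hb, Finset.sum_div]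
  refine Finset.sum_congr rfl fun k _ => ?_
  rw [← hb, bernBasis]
  ring

theorem bernBasis_nonneg {l u x : ℝ} (hx : x ∈ Set.Icc l u) (m k : ℕ) :
    0 ≤ bernBasis l u m k x := by
  have h₁ := sub_nonneg.2 hx.1
  have h₂ := sub_nonneg.2 hx.2
  have h₃ := sub_nonneg.2 (hx.1.trans hx.2)
  unfold bernBasis
  positivity

/-- Bernstein Gradient Lower Bound: if `c (k+1) − c k ≥ δ > 0` for all
`k ∈ {0,…,n−1}`, then for every `x ∈ [l,u]`, `|σ'(x)| ≥ nδ/(u−l)`; in fact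
`σ'(x) ≥ nδ/(u−l) > 0`. -/
theorem bernstein_gradient_lower_bound (l u : ℝ) (hlu : l < u) (n : ℕ) (hn : 1 ≤ n)
    (δ : ℝ) (hδ : 0 < δ) (c : ℕ → ℝ) (hc : ∀ k < n, δ ≤ c (k + 1) - c k) :
    ∀ x ∈ Set.Icc l u,
      n * δ / (u - l) ≤ |deriv (bernAct l u n c) x| ∧
      n * δ / (u - l) ≤ deriv (bernAct l u n c) x ∧
      0 < n * δ / (u - l) := by
  intro x hx
  obtain ⟨m, rfl⟩ := Nat.exists_eq_add_of_le' hn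
  have hpos : 0 < u - l := sub_pos.2 hlu
  have hsum : δ ≤ ∑ k ∈ Finset.range (m + 1), (c (k + 1) - c k) * bernBasis l u m k x := by
    calc δ = ∑ k ∈ Finset.range (m + 1), δ * bernBasis l u m k x := by
          rw [← Finset.mul_sum, sum_bernBasis hlu, mul_one]
      _ ≤ _ := Finset.sum_le_sum fun k hk => mul_le_mul_of_nonneg_right
          (hc k (Finset.mem_range.1 hk)) (bernBasis_nonneg hx m k)
  have hle : ((m + 1 : ℕ) : ℝ) * δ / (u - l) ≤ deriv (bernAct l u (m + 1) c) x := by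
    rw [(hasDerivAt_bernAct hlu m c x).deriv, mul_div_right_comm, Nat.cast_add_one]
    gcongr
  exact ⟨hle.trans (le_abs_self _), hle, by positivity⟩
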